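/- Under condition [A], if a sequence κ = κ_n satisfies lim_{n→∞} κ/n = 0 and lim_{n→∞} κ/√n = ∞, then for every ε > 0, lim_{n→∞} (n/κ²) ln P(|R(n) − Z(n)|/κ > ε) = −∞; in particular, the sequences R̃(n) := (R(n) − an)/κ and Z̃(n) := (Z(n) − an)/κ are exponentially equivalent at speed κ²/n and satisfy the same large deviation principle. -/

import Mathlib

noncomputable section

/-- A chain with unbounded variable length memory over the binary alphabet `{0,1}`,
with memory parameter `v ≥ 1`.  For `k ∈ ℕ ∪ {0}` (the distance from the current
position to the nearest `1`) and a word `w` of `v - 1` letters (the letters standing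
to the left of that `1`), `p k w` is the probability of appending the character `1`.
The structure records the sample space, the appended characters `X n = r_n(n)`,
the full configuration `cfg`, the position `mpos ω n` of the rightmost `1` among the
coordinates `≤ n`, and the Markov transition rule `htrans`. -/
structure VLMC (v : ℕ) (p : ℕ → (Fin (v - 1) → Bool) → ℝ) where
  /-- the sample space -/
  Ω : Type
  [mΩ : MeasurableSpace Ω]
  /-- the underlying probability measure -/
  P : MeasureTheory.Measure Ω
  hprob : MeasureTheory.IsProbabilityMeasure P
  hv : 0 < v
  /-- the (fixed) initial configuration; only the coordinates `i ≤ 0` are relevant -/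
  r0 : ℤ → Bool
  /-- `X n` is the random character appended at step `n`, for `n ≥ 1` -/
  X : ℕ → Ω → Bool
  hXmeas : ∀ n, Measurable (X n)
  /-- the full configuration (it does not change in time: at time `n` only the
  coordinates `≤ n` are relevant) -/
  cfg : Ω → ℤ → Bool
  hcfg : ∀ ω i, cfg ω i = if i ≤ 0 then r0 i else X i.toNat ω
  /-- `mpos ω n` is the position of the rightmost `1` among the coordinates `≤ n` -/
  mpos : Ω → ℕ → ℤ
  hmpos : ∀ ω n, mpos ω n ≤ (n : ℤ) ∧ cfg ω (mpos ω n) = true ∧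
    ∀ i : ℤ, mpos ω n < i → i ≤ (n : ℤ) → cfg ω i = false
  /-- the transition rule: on any cylinder (in the appended characters) on which the
  distance from `n` to the nearest `1` equals `k` and the word of the `v - 1` letters
  standing to the left of that `1` equals `w`, the conditional probability that the
  character appended at step `n + 1` equals `1` is `p k w`. -/
  htrans : ∀ (n : ℕ) (b : Fin n → Bool) (k : ℕ) (w : Fin (v - 1) → Bool),
    (∀ ω, (∀ i : Fin n, X (i.1 + 1) ω = b i) →
      ((n : ℤ) - mpos ω n = (k : ℤ) ∧
        ∀ j : Fin (v - 1), cfg ω (mpos ω n - ((v : ℤ) - 1) + (j.1 : ℤ)) = w j)) →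
    P {ω | (∀ i : Fin n, X (i.1 + 1) ω = b i) ∧ X (n + 1) ω = true}
      = ENNReal.ofReal (p k w) * P {ω | ∀ i : Fin n, X (i.1 + 1) ω = b i}

open MeasureTheory Filter

namespace VLMC

variable {v : ℕ} {p : ℕ → (Fin (v - 1) → Bool) → ℝ}

/-- Condition [A]: the initial configuration contains at least one `1`, and all the
transition probabilities lie between `δ2` and `δ1`, where `0 < δ2 < δ1 < 1`. -/
def CondA (S : VLMC v p) (δ1 δ2 : ℝ) : Prop :=
  (∃ i : ℤ, i ≤ 0 ∧ S.r0 i = true) ∧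
  0 < δ2 ∧ δ2 < δ1 ∧ δ1 < 1 ∧
  ∀ (k : ℕ) (w : Fin (v - 1) → Bool), δ2 ≤ p k w ∧ p k w ≤ δ1

/-- `R n`, the number of `1`s appended during the first `n` steps -/
def R (S : VLMC v p) (n : ℕ) (ω : S.Ω) : ℕ :=
  ∑ k ∈ Finset.Icc 1 n, (S.X k ω).toNat

/-- `Y(n) = y₀ = (0,(0,…,0,1))`, i.e. the character at position `n` is `1` and the
`v - 1` letters to its left are all `0` -/
def hitY0 (S : VLMC v p) (ω : S.Ω) (n : ℕ) : Prop :=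
  S.mpos ω n = (n : ℤ) ∧
    ∀ j : Fin (v - 1), S.cfg ω ((n : ℤ) - ((v : ℤ) - 1) + (j.1 : ℤ)) = false

/-- `T k`, the time of the `k`-th visit of the chain `Y` to the state `y₀`
(`T 0 = 0`) -/
def T (S : VLMC v p) : ℕ → S.Ω → ℕ
  | 0, _ => 0
  | k + 1, ω => sInf {n | T S k ω < n ∧ S.hitY0 ω n}

/-- `τ_k = T_k - T_{k-1}`, the spacings between consecutive visits to `y₀` -/
def tau (S : VLMC v p) (k : ℕ) (ω : S.Ω) : ℕ := S.T k ω - S.T (k - 1) ω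

/-- `ζ_k`, the number of `1`s appended at the times `n ∈ (T_{k-1}, T_k]` -/
def zeta (S : VLMC v p) (k : ℕ) (ω : S.Ω) : ℕ :=
  ∑ n ∈ Finset.Ioc (S.T (k - 1) ω) (S.T k ω), (S.X n ω).toNat

/-- `ν(n) = max {k ≥ 0 : T_k < n}` -/
def nu (S : VLMC v p) (n : ℕ) (ω : S.Ω) : ℕ := sSup {k | S.T k ω < n}

/-- the generalized renewal process `Z(n) = Σ_{k=0}^{ν(n)} ζ_k` (with `ζ_0 = 0`) -/
def Z (S : VLMC v p) (n : ℕ) (ω : S.Ω) : ℕ :=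
  ∑ k ∈ Finset.range (S.nu n ω + 1), S.zeta k ω

/-- `a = E ζ / E τ`, where `(τ, ζ) = (τ_2, ζ_2)` has the common distribution of the
regeneration vectors `ξ_k = (τ_k, ζ_k)`, `k ≥ 2` -/
def a (S : VLMC v p) : ℝ :=
  (∫ ω, (S.zeta 2 ω : ℝ) ∂S.P) / (∫ ω, (S.tau 2 ω : ℝ) ∂S.P)

/-- `σ² = E (ζ - aτ)² / E τ` -/
def sigma2 (S : VLMC v p) : ℝ :=
  (∫ ω, ((S.zeta 2 ω : ℝ) - S.a * (S.tau 2 ω : ℝ)) ^ 2 ∂S.P) /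
    (∫ ω, (S.tau 2 ω : ℝ) ∂S.P)

/-- `ψ(λ,μ) = E e^{λτ + μζ}` (as an extended nonnegative real number) -/
def psi (S : VLMC v p) (l m : ℝ) : ENNReal :=
  ∫⁻ ω, ENNReal.ofReal (Real.exp (l * S.tau 2 ω + m * S.zeta 2 ω)) ∂S.P

/-- `ψ₁(λ,μ) = E e^{λτ₁ + μζ₁}` -/
def psi1 (S : VLMC v p) (l m : ℝ) : ℝ :=
  ∫ ω, Real.exp (l * S.tau 1 ω + m * S.zeta 1 ω) ∂S.P

/-- the deviation function `D(θ,α) = sup {λθ + μα : A(λ,μ) ≤ 0}` where `A = ln ψ`,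
so that `A(λ,μ) ≤ 0 ↔ ψ(λ,μ) ≤ 1` -/
def D2 (S : VLMC v p) (θ α : ℝ) : ℝ :=
  sSup {x | ∃ l m : ℝ, S.psi l m ≤ 1 ∧ x = l * θ + m * α}

/-- `D(α) = D(1,α)` -/
def D (S : VLMC v p) (α : ℝ) : ℝ := S.D2 1 α

/-- the chain starts from the state `y₀ = (0,(0,…,0,1))`, i.e. `Y(0) = y₀`: the
initial configuration has a `1` at position `0` preceded by `v - 1` zeros -/
def StartsAtY0 (S : VLMC v p) : Prop :=
  S.r0 0 = true ∧ ∀ i : ℤ, 1 - (v : ℤ) ≤ i → i < 0 → S.r0 i = false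

end VLMC

namespace VLMC

/-- The sequence `s n` of real random variables satisfies the large deviation
principle in `ℝ` with normalizing function `φ` (tending to infinity) and rate
function `I : ℝ → [0,∞]`: the sublevel sets `{I ≤ c}` are compact, and for every
Borel set `B` the upper bound along the closure of `B` and the lower bound along
the interior of `B` hold (Definition 1.1; here `ln 0 = -∞`, via `ENNReal.log`). -/
def SatisfiesLDP {Ω : Type*} {mΩ : MeasurableSpace Ω} (P : MeasureTheory.Measure Ω)
    (s : ℕ → Ω → ℝ) (φ : ℕ → ℝ) (I : ℝ → EReal) : Prop :=
  Filter.Tendsto φ Filter.atTop Filter.atTop ∧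
  (∀ c : ℝ, 0 ≤ c → IsCompact {y : ℝ | I y ≤ (c : EReal)}) ∧
  ∀ B : Set ℝ, MeasurableSet B →
    Filter.limsup
        (fun n => (((φ n)⁻¹ : ℝ) : EReal) * ENNReal.log (P {ω | s n ω ∈ B}))
        Filter.atTop ≤ -(⨅ y ∈ closure B, I y) ∧
    -(⨅ y ∈ interior B, I y) ≤
      Filter.liminf
        (fun n => (((φ n)⁻¹ : ℝ) : EReal) * ENNReal.log (P {ω | s n ω ∈ B}))
        Filter.atTop

section LargeDeviations

/-- `φ⁻¹ log z < x` unfolds to `z < e^{xφ}`. -/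
lemma inv_mul_log_lt_iff {φ : ℝ} (hφ : 0 < φ) (z : ENNReal) (x : ℝ) :
    ((φ⁻¹ : ℝ) : EReal) * ENNReal.log z < x ↔ z < ENNReal.ofReal (Real.exp (x * φ)) := by
  have hi : 0 < φ⁻¹ := inv_pos.mpr hφ
  induction z with
  | top => simp [EReal.coe_mul_top_of_pos hi]
  | coe z =>
    rcases eq_or_ne z 0 with rfl | hz
    · simp [EReal.coe_mul_bot_of_pos hi, EReal.bot_lt_coe, Real.exp_pos]
    · have hz' : (0 : ℝ) < z := by positivity
      have : ENNReal.log (z : ENNReal) = (Real.log z : EReal) := by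
        rw [← ENNReal.ofReal_coe_nnreal, ENNReal.log_ofReal_of_pos hz']
      rw [this, ← EReal.coe_mul, EReal.coe_lt_coe_iff, ← ENNReal.ofReal_coe_nnreal,
        ENNReal.ofReal_lt_ofReal_iff (Real.exp_pos _), ← Real.log_lt_iff_lt_exp hz',
        inv_mul_lt_iff₀ hφ, mul_comm]

variable {Ω : Type*} {mΩ : MeasurableSpace Ω} {P : Measure Ω} {φ : ℕ → ℝ}
  {A B C : ℕ → Set Ω}

/-- On the exponential scale `φ`, a superexponentially small set contributes nothing to
the measure of a union. -/
lemma eventually_inv_mul_log_lt (hφ : Tendsto φ atTop atTop) (hABC : ∀ n, A n ⊆ B n ∪ C n)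
    (hC : Tendsto (fun n => (((φ n)⁻¹ : ℝ) : EReal) * ENNReal.log (P (C n))) atTop (nhds ⊥))
    {x x' : ℝ} (hx : x < x') :
    ∀ᶠ n in atTop, (((φ n)⁻¹ : ℝ) : EReal) * ENNReal.log (P (B n)) < x →
      (((φ n)⁻¹ : ℝ) : EReal) * ENNReal.log (P (A n)) < x' := by
  have hC' := (EReal.tendsto_nhds_bot_iff_real.mp hC) x
  filter_upwards [hC', hφ.eventually_gt_atTop 0, hφ.eventually_ge_atTop (Real.log 2 / (x' - x))]
    with n h1 h2 h3 hB
  rw [inv_mul_log_lt_iff h2] at h1 hB ⊢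
  calc P (A n) ≤ P (B n) + P (C n) := (measure_mono (hABC n)).trans (measure_union_le _ _)
    _ < ENNReal.ofReal (Real.exp (x * φ n)) + ENNReal.ofReal (Real.exp (x * φ n)) :=
        ENNReal.add_lt_add hB h1
    _ = ENNReal.ofReal (Real.exp (Real.log 2 + x * φ n)) := by
        rw [← ENNReal.ofReal_add (Real.exp_pos _).le (Real.exp_pos _).le, Real.exp_add,
          Real.exp_log two_pos, two_mul]
    _ ≤ ENNReal.ofReal (Real.exp (x' * φ n)) := by
        apply ENNReal.ofReal_le_ofReal
        rw [Real.exp_le_exp]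
        rw [div_le_iff₀ (sub_pos.mpr hx)] at h3
        linarith

lemma limsup_inv_mul_log_le (hφ : Tendsto φ atTop atTop) (hABC : ∀ n, A n ⊆ B n ∪ C n)
    (hC : Tendsto (fun n => (((φ n)⁻¹ : ℝ) : EReal) * ENNReal.log (P (C n))) atTop (nhds ⊥)) :
    limsup (fun n => (((φ n)⁻¹ : ℝ) : EReal) * ENNReal.log (P (A n))) atTop ≤
      limsup (fun n => (((φ n)⁻¹ : ℝ) : EReal) * ENNReal.log (P (B n))) atTop := by
  refine le_of_forall_gt_imp_ge_of_dense fun c hc => ?_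
  obtain ⟨x, hx1, hx2⟩ := EReal.lt_iff_exists_real_btwn.mp hc
  obtain ⟨x', hx1', hx2'⟩ := EReal.lt_iff_exists_real_btwn.mp hx2
  refine limsup_le_of_le (by isBoundedDefault) ?_
  filter_upwards [eventually_inv_mul_log_lt hφ hABC hC (EReal.coe_lt_coe_iff.mp hx1'),
    eventually_lt_of_limsup_lt hx1] with n h1 h2
  exact ((h1 h2).trans hx2').le

lemma liminf_inv_mul_log_le (hφ : Tendsto φ atTop atTop) (hABC : ∀ n, A n ⊆ B n ∪ C n)
    (hC : Tendsto (fun n => (((φ n)⁻¹ : ℝ) : EReal) * ENNReal.log (P (C n))) atTop (nhds ⊥)) :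
    liminf (fun n => (((φ n)⁻¹ : ℝ) : EReal) * ENNReal.log (P (A n))) atTop ≤
      liminf (fun n => (((φ n)⁻¹ : ℝ) : EReal) * ENNReal.log (P (B n))) atTop := by
  refine le_of_forall_lt_imp_le_of_dense fun c hc => ?_
  obtain ⟨x, hx1, hx2⟩ := EReal.lt_iff_exists_real_btwn.mp hc
  obtain ⟨x', hx1', hx2'⟩ := EReal.lt_iff_exists_real_btwn.mp hx2
  refine le_liminf_of_le (by isBoundedDefault) ?_
  filter_upwards [eventually_inv_mul_log_lt hφ hABC hC (EReal.coe_lt_coe_iff.mp hx1'),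
    eventually_lt_of_lt_liminf hx2'] with n h1 h2
  by_contra! h
  exact absurd (h1 (h.trans hx1)) (not_lt.mpr h2.le)

/-- Exponentially equivalent sequences satisfy the same large deviation principles. -/
lemma SatisfiesLDP.of_exponentially_equivalent [IsProbabilityMeasure P] {s t : ℕ → Ω → ℝ}
    {I : ℝ → EReal}
    (hst : ∀ ε > (0 : ℝ), Tendsto (fun n => (((φ n)⁻¹ : ℝ) : EReal) *
      ENNReal.log (P {ω | ε < |s n ω - t n ω|})) atTop (nhds ⊥))
    (h : SatisfiesLDP P s φ I) : SatisfiesLDP P t φ I := by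
  obtain ⟨hφ, hI, hB⟩ := h
  refine ⟨hφ, hI, fun B _ => ⟨?_, ?_⟩⟩
  · have hpos : ∀ y, 0 ≤ I y := by
      have := (hB Set.univ MeasurableSet.univ).2
      simp only [Set.mem_univ, Set.ofPred_true, measure_univ, ENNReal.log_one, mul_zero,
        liminf_const, interior_univ, iInf_true] at this
      intro y
      have h0 : 0 ≤ ⨅ y, I y := by simpa using EReal.neg_le_neg_iff.mpr this
      exact h0.trans (iInf_le _ y)
    rw [EReal.le_neg]
    refine le_of_forall_lt_imp_le_of_dense fun c hc => ?_
    obtain ⟨x, hx1, hx2⟩ := EReal.lt_iff_exists_real_btwn.mp hc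
    refine hx1.le.trans ?_
    obtain ⟨δ, hδ, hinf⟩ : ∃ δ > 0, (x : EReal) ≤ ⨅ y ∈ Metric.cthickening δ B, I y := by
      rcases lt_or_ge x 0 with hx | hx
      · refine ⟨1, one_pos, le_iInf₂ fun y _ => le_trans ?_ (hpos y)⟩
        exact_mod_cast hx.le
      · have hd : Disjoint {y | I y ≤ x} (closure B) := by
          rw [Set.disjoint_left]
          intro y hy hyB
          exact absurd (hx2.trans_le (iInf₂_le y hyB)) (not_lt.mpr hy)
        obtain ⟨δ, hδ, hdis⟩ := hd.exists_cthickenings (hI x hx) isClosed_closure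
        refine ⟨δ, hδ, le_iInf₂ fun y hy => ?_⟩
        by_contra! hlt
        rw [Metric.cthickening_closure] at hdis
        exact Set.disjoint_left.mp hdis
          (Metric.self_subset_cthickening {y | I y ≤ x} hlt.le) hy
    rw [EReal.le_neg]
    calc _ ≤ limsup (fun n => (((φ n)⁻¹ : ℝ) : EReal) *
          ENNReal.log (P {ω | s n ω ∈ Metric.cthickening δ B})) atTop := by
          refine limsup_inv_mul_log_le hφ (fun n ω hω => ?_) (hst δ hδ)
          by_cases hd : δ < |s n ω - t n ω|
          · exact Or.inr hd
          · exact Or.inl (Metric.mem_cthickening_of_dist_le _ (t n ω) _ _ hω (not_lt.mp hd))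
      _ ≤ -(⨅ y ∈ Metric.cthickening δ B, I y) := by
          have := (hB _ (Metric.isClosed_cthickening (δ := δ) (E := B)).measurableSet).1
          rwa [Metric.isClosed_cthickening.closure_eq] at this
      _ ≤ -(x : EReal) := EReal.neg_le_neg_iff.mpr hinf
  · rw [EReal.neg_le]
    refine le_iInf₂ fun y hy => ?_
    rw [EReal.neg_le]
    obtain ⟨δ, hδ, hball⟩ := Metric.isOpen_iff.mp isOpen_interior y hy
    calc -I y ≤ -(⨅ z ∈ Metric.ball y (δ / 2), I z) :=
          EReal.neg_le_neg_iff.mpr (iInf₂_le y (Metric.mem_ball_self (half_pos hδ)))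
      _ ≤ liminf (fun n => (((φ n)⁻¹ : ℝ) : EReal) *
          ENNReal.log (P {ω | s n ω ∈ Metric.ball y (δ / 2)})) atTop := by
          have := (hB _ (Metric.isOpen_ball (x := y) (ε := δ / 2)).measurableSet).2
          rwa [Metric.isOpen_ball.interior_eq] at this
      _ ≤ _ := by
          refine liminf_inv_mul_log_le hφ (fun n ω hω => ?_) (hst (δ / 2) (half_pos hδ))
          by_cases hd : δ / 2 < |s n ω - t n ω|
          · exact Or.inr hd
          · refine Or.inl (show t n ω ∈ B from interior_subset (hball ?_))
            have h1 : dist (s n ω) y < δ / 2 := hω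
            have h2 : dist (t n ω) (s n ω) ≤ δ / 2 := by
              rw [dist_comm]; exact not_lt.mp hd
            exact Metric.mem_ball.mpr (by linarith [dist_triangle (t n ω) (s n ω) y])

end LargeDeviations

section Chain

attribute [local instance] mΩ hprob

variable {v : ℕ} {p : ℕ → (Fin (v - 1) → Bool) → ℝ} (S : VLMC v p)

/-- The characters appended during the first `n` steps. -/
def path (n : ℕ) (ω : S.Ω) : Fin n → Bool := fun i => S.X (i.1 + 1) ω

/-- The event `A` depends only on the first `n` appended characters. -/
def DeterminedBy (n : ℕ) (A : Set S.Ω) : Prop :=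
  ∀ ω ω', (∀ i, 1 ≤ i → i ≤ n → S.X i ω = S.X i ω') → ω ∈ A → ω' ∈ A

/-- The event that the letters appended after time `N` start with `v - 1` zeros and a one. -/
def block (N : ℕ) : Set S.Ω :=
  {ω | ∀ i < v, S.X (N + i + 1) ω = decide (i + 1 = v)}

/-- The event that none of the `m` successive blocks of length `v` after time `N` is
`0…01`. -/
def noBlock (N m : ℕ) : Set S.Ω := {ω | ∀ i < m, ω ∉ S.block (N + i * v)}

lemma measurable_path (n : ℕ) : Measurable (S.path n) := by
  exact measurable_pi_lambda _ fun i => S.hXmeas _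

lemma cfg_eq_of_path_eq {n : ℕ} {ω ω' : S.Ω} (h : S.path n ω = S.path n ω') {i : ℤ}
    (hi : i ≤ n) : S.cfg ω i = S.cfg ω' i := by
  rw [S.hcfg, S.hcfg]
  split_ifs with h0
  · rfl
  · have := congrFun h ⟨i.toNat - 1, by omega⟩
    simpa [path, show i.toNat - 1 + 1 = i.toNat by omega] using this

lemma mpos_eq {n : ℕ} {ω : S.Ω} {m : ℤ} (hm : m ≤ n) (h1 : S.cfg ω m = true)
    (h0 : ∀ i : ℤ, m < i → i ≤ n → S.cfg ω i = false) : S.mpos ω n = m := by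
  obtain ⟨ha, hb, hc⟩ := S.hmpos ω n
  rcases lt_trichotomy (S.mpos ω n) m with h | h | h
  · simp [hc m h hm] at h1
  · exact h
  · simp [h0 _ h ha] at hb

lemma mpos_eq_of_path_eq {n : ℕ} {ω ω' : S.Ω} (h : S.path n ω = S.path n ω') :
    S.mpos ω n = S.mpos ω' n := by
  obtain ⟨ha, hb, hc⟩ := S.hmpos ω' n
  refine S.mpos_eq ha ?_ fun i hi hin => ?_
  · rw [S.cfg_eq_of_path_eq h ha, hb]
  · rw [S.cfg_eq_of_path_eq h hin, hc i hi hin]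

/-- On a cylinder the next character is `1` with one of the transition probabilities. -/
lemma exists_transition (n : ℕ) (b : Fin n → Bool) :
    ∃ k w, S.P (S.path n ⁻¹' {b} ∩ {ω | S.X (n + 1) ω = true})
      = ENNReal.ofReal (p k w) * S.P (S.path n ⁻¹' {b}) := by
  have hset : S.path n ⁻¹' {b} = {ω | ∀ i : Fin n, S.X (i.1 + 1) ω = b i} := by
    ext ω; simp [path, funext_iff]
  have hset' : S.path n ⁻¹' {b} ∩ {ω | S.X (n + 1) ω = true} =
      {ω | (∀ i : Fin n, S.X (i.1 + 1) ω = b i) ∧ S.X (n + 1) ω = true} := by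
    rw [hset]; rfl
  rcases (S.path n ⁻¹' {b}).eq_empty_or_nonempty with he | ⟨ω₀, hω₀⟩
  · exact ⟨0, fun _ => false, by simp [he]⟩
  · refine ⟨((n : ℤ) - S.mpos ω₀ n).toNat,
      fun j => S.cfg ω₀ (S.mpos ω₀ n - ((v : ℤ) - 1) + (j.1 : ℤ)), ?_⟩
    rw [hset', hset]
    refine S.htrans n b _ _ fun ω hω => ?_
    have hp : S.path n ω = S.path n ω₀ := by
      rw [show S.path n ω₀ = b from hω₀]; exact funext hω
    have hle := (S.hmpos ω₀ n).1
    have hm := S.mpos_eq_of_path_eq hp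
    refine ⟨by rw [hm]; omega, fun j => ?_⟩
    rw [hm]
    exact S.cfg_eq_of_path_eq hp (by have := j.2; omega)

variable {S}

lemma DeterminedBy.eq_preimage {n : ℕ} {A : Set S.Ω} (hA : S.DeterminedBy n A) :
    A = S.path n ⁻¹' (S.path n '' A) := by
  refine (Set.subset_preimage_image _ _).antisymm ?_
  rintro ω ⟨ω', hω', h⟩
  refine hA ω' ω (fun i h1 hn => ?_) hω'
  have := congrFun h ⟨i - 1, by omega⟩
  simpa [path, Nat.sub_add_cancel h1] using this

lemma DeterminedBy.measurableSet {n : ℕ} {A : Set S.Ω} (hA : S.DeterminedBy n A) :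
    MeasurableSet A := by
  rw [hA.eq_preimage]
  exact S.measurable_path n (Set.toFinite _).measurableSet

/-- Every character is appended with conditional probability at least
`min δ2 (1 - δ1)`, whatever the past. -/
lemma DeterminedBy.mul_measure_le {n : ℕ} {A : Set S.Ω} (hA : S.DeterminedBy n A)
    {δ1 δ2 : ℝ} (h : S.CondA δ1 δ2) (x : Bool) :
    ENNReal.ofReal (min δ2 (1 - δ1)) * S.P A ≤ S.P (A ∩ {ω | S.X (n + 1) ω = x}) := by
  obtain ⟨-, h2, h21, h1, hp⟩ := h
  have hX : ∀ y, MeasurableSet {ω | S.X (n + 1) ω = y} := fun y =>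
    S.hXmeas (n + 1) (measurableSet_singleton y)
  have hcyl : ∀ b : Fin n → Bool, MeasurableSet (S.path n ⁻¹' {b}) := fun b =>
    S.measurable_path n (measurableSet_singleton b)
  have hone : ∀ b : Fin n → Bool, ENNReal.ofReal (min δ2 (1 - δ1)) * S.P (S.path n ⁻¹' {b}) ≤
      S.P (S.path n ⁻¹' {b} ∩ {ω | S.X (n + 1) ω = x}) := by
    intro b
    obtain ⟨k, w, hkw⟩ := S.exists_transition n b
    obtain ⟨hp2, hp1⟩ := hp k w
    cases x with
    | true =>
      rw [hkw]
      gcongr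
      exact (min_le_left _ _).trans hp2
    | false =>
      have hsplit := measure_inter_add_sdiff (μ := S.P) (S.path n ⁻¹' {b}) (hX true)
      have hdiff : S.path n ⁻¹' {b} \ {ω | S.X (n + 1) ω = true} =
          S.path n ⁻¹' {b} ∩ {ω | S.X (n + 1) ω = false} := by
        ext ω; simp
      rw [hdiff, hkw] at hsplit
      have hfin : ENNReal.ofReal (p k w) * S.P (S.path n ⁻¹' {b}) ≠ ⊤ :=
        ENNReal.mul_ne_top ENNReal.ofReal_ne_top (measure_ne_top _ _)
      rw [← ENNReal.add_le_add_iff_left hfin, hsplit, ← add_mul,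
        ← ENNReal.ofReal_add (by linarith) (le_min h2.le (by linarith))]
      refine mul_le_of_le_one_left zero_le (ENNReal.ofReal_le_one.mpr ?_)
      linarith [min_le_right δ2 (1 - δ1)]
  classical
  have hsum := sum_measure_preimage_singleton (μ := S.P) (S.path n '' A).toFinset
    fun b _ => hcyl b
  have hsum' := sum_measure_preimage_singleton (μ := S.P.restrict {ω | S.X (n + 1) ω = x})
    (S.path n '' A).toFinset fun b _ => hcyl b
  rw [Set.coe_toFinset, ← hA.eq_preimage] at hsum hsum'
  rw [Measure.restrict_apply hA.measurableSet] at hsum'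
  rw [← hsum, ← hsum', Finset.mul_sum]
  refine Finset.sum_le_sum fun b _ => ?_
  rw [Measure.restrict_apply (hcyl b)]
  exact hone b

lemma DeterminedBy.pow_mul_measure_le {n : ℕ} {A : Set S.Ω} (hA : S.DeterminedBy n A)
    {δ1 δ2 : ℝ} (h : S.CondA δ1 δ2) (s : ℕ → Bool) (m : ℕ) :
    ENNReal.ofReal (min δ2 (1 - δ1)) ^ m * S.P A ≤
      S.P (A ∩ {ω | ∀ i < m, S.X (n + i + 1) ω = s i}) := by
  induction m with
  | zero => simp
  | succ m ih =>
    have hdet : S.DeterminedBy (n + m) (A ∩ {ω | ∀ i < m, S.X (n + i + 1) ω = s i}) := by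
      rintro ω ω' hωω' ⟨h1, h2⟩
      refine ⟨hA ω ω' (fun i hi hn => hωω' i hi (by omega)) h1, fun i hi => ?_⟩
      rw [← hωω' _ (by omega) (by omega), h2 i hi]
    calc _ = ENNReal.ofReal (min δ2 (1 - δ1)) *
          (ENNReal.ofReal (min δ2 (1 - δ1)) ^ m * S.P A) := by rw [pow_succ']; ring
      _ ≤ _ := (mul_le_mul_right ih _).trans (hdet.mul_measure_le h (s m))
      _ ≤ _ := by
        refine measure_mono ?_
        rintro ω ⟨⟨h1, h2⟩, h3⟩
        refine ⟨h1, fun i hi => ?_⟩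
        rcases Nat.lt_succ_iff_lt_or_eq.mp hi with hi | rfl
        · exact h2 i hi
        · exact h3

lemma determinedBy_noBlock (N m : ℕ) : S.DeterminedBy (N + m * v) (S.noBlock N m) := by
  intro ω ω' h hω i hi hblock
  refine hω i hi fun j hj => ?_
  have : i * v + v ≤ m * v := by
    rw [← Nat.succ_mul]; exact Nat.mul_le_mul_right _ hi
  rw [h _ (by omega) (by omega)]
  exact hblock j hj

/-- The probability of seeing no block `0…01` decays geometrically. -/
lemma measure_noBlock_le {δ1 δ2 : ℝ} (h : S.CondA δ1 δ2) (N m : ℕ) :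
    S.P (S.noBlock N m) ≤ ENNReal.ofReal (1 - min δ2 (1 - δ1) ^ v) ^ m := by
  have hq0 : 0 ≤ min δ2 (1 - δ1) := le_min h.2.1.le (by linarith [h.2.2.2.1])
  have hq1 : min δ2 (1 - δ1) ≤ 1 :=
    (min_le_left _ _).trans (h.2.2.1.trans h.2.2.2.1).le
  induction m with
  | zero => simpa using prob_le_one
  | succ m ih =>
    set c := min δ2 (1 - δ1) ^ v with hc
    have hc0 : 0 ≤ c := pow_nonneg hq0 v
    have hc1 : c ≤ 1 := pow_le_one₀ hq0 hq1
    have hdet := determinedBy_noBlock (S := S) N m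
    have hpat := hdet.pow_mul_measure_le h (fun i => decide (i + 1 = v)) v
    rw [← ENNReal.ofReal_pow hq0, ← hc] at hpat
    have hdet' := determinedBy_noBlock (S := S) N (m + 1)
    have hsub : S.noBlock N m ∩ S.block (N + m * v) ∪ S.noBlock N (m + 1) ⊆ S.noBlock N m := by
      rintro ω (hω | hω)
      · exact hω.1
      · exact fun i hi => hω i (by omega)
    have hdisj : Disjoint (S.noBlock N m ∩ S.block (N + m * v)) (S.noBlock N (m + 1)) := by
      rw [Set.disjoint_left]
      exact fun ω hω hω' => hω' m (by omega) hω.2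
    have hle := measure_mono (μ := S.P) hsub
    rw [measure_union hdisj hdet'.measurableSet] at hle
    have hfin : ENNReal.ofReal c * S.P (S.noBlock N m) ≠ ⊤ :=
      ENNReal.mul_ne_top ENNReal.ofReal_ne_top (measure_ne_top _ _)
    have hstep : S.P (S.noBlock N (m + 1)) ≤ ENNReal.ofReal (1 - c) * S.P (S.noBlock N m) := by
      rw [← ENNReal.add_le_add_iff_left hfin, ← add_mul,
        ← ENNReal.ofReal_add hc0 (by linarith), add_sub_cancel, ENNReal.ofReal_one, one_mul]
      exact (add_le_add_left hpat _).trans hle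
    rw [pow_succ']
    exact hstep.trans (mul_le_mul_right ih _)

lemma hitY0_of_mem_block {N : ℕ} {ω : S.Ω} (h : ω ∈ S.block N) : S.hitY0 ω (N + v) := by
  have hv := S.hv
  refine ⟨S.mpos_eq le_rfl ?_ fun i h1 h2 => by omega, fun j => ?_⟩
  · rw [S.hcfg, if_neg (by omega)]
    have := h (v - 1) (by omega)
    rw [show ((N + v : ℕ) : ℤ).toNat = N + (v - 1) + 1 by omega, this]
    simp; omega
  · have hj := j.2
    rw [S.hcfg, if_neg (by omega)]
    have := h j (by omega)
    rw [show (((N + v : ℕ) : ℤ) - ((v : ℤ) - 1) + (j.1 : ℤ)).toNat = N + j + 1 by omega, this]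
    simp; omega

lemma ae_frequently_hitY0 {δ1 δ2 : ℝ} (h : S.CondA δ1 δ2) :
    ∀ᵐ ω ∂S.P, ∀ N, ∃ n, N < n ∧ S.hitY0 ω n := by
  rw [ae_all_iff]
  intro N
  rw [ae_iff]
  have hq0 : 0 < min δ2 (1 - δ1) := lt_min h.2.1 (by linarith [h.2.2.2.1])
  have hlim : Tendsto (fun m => ENNReal.ofReal (1 - min δ2 (1 - δ1) ^ v) ^ m) atTop (nhds 0) := by
    refine ENNReal.tendsto_pow_atTop_nhds_zero_of_lt_one ?_
    rw [ENNReal.ofReal_lt_one]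
    linarith [pow_pos hq0 v]
  refine le_antisymm (ge_of_tendsto' hlim fun m => ?_) zero_le
  refine (measure_mono ?_).trans (measure_noBlock_le h N m)
  intro ω hω i _ hb
  exact hω ⟨_, by have := S.hv; omega, hitY0_of_mem_block hb⟩

section Renewal

variable {ω : S.Ω} (hinf : ∀ N, ∃ n, N < n ∧ S.hitY0 ω n)

lemma R_mono (ω : S.Ω) : Monotone fun n => S.R n ω := fun _ _ h =>
  Finset.sum_le_sum_of_subset (Finset.Icc_subset_Icc_right h)

lemma R_add_sum_Ioc {s t : ℕ} (hst : s ≤ t) (ω : S.Ω) :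
    S.R s ω + ∑ k ∈ Finset.Ioc s t, (S.X k ω).toNat = S.R t ω := by
  have hI : ∀ n, Finset.Icc 1 n = Finset.Ioc 0 n := fun n => by ext; simp; omega
  rw [R, R, hI, hI]
  exact Finset.sum_Ioc_consecutive _ (Nat.zero_le s) hst

lemma R_le_R_add {s t : ℕ} (hst : s ≤ t) (ω : S.Ω) : S.R t ω ≤ S.R s ω + (t - s) := by
  rw [← R_add_sum_Ioc hst]
  gcongr
  refine (Finset.sum_le_card_nsmul _ _ 1 fun k _ => Bool.toNat_le _).trans ?_
  simp

include hinf

lemma T_lt_T_succ (k : ℕ) : S.T k ω < S.T (k + 1) ω :=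
  (Nat.sInf_mem (s := {n | S.T k ω < n ∧ S.hitY0 ω n}) (hinf _)).1

lemma strictMono_T : StrictMono fun k => S.T k ω := strictMono_nat_of_lt_succ (T_lt_T_succ hinf)

lemma sum_zeta_eq_R (k : ℕ) : ∑ j ∈ Finset.range (k + 1), S.zeta j ω = S.R (S.T k ω) ω := by
  induction k with
  | zero => simp [zeta, R, T]
  | succ k ih =>
    rw [Finset.sum_range_succ, ih]
    exact R_add_sum_Ioc (T_lt_T_succ hinf k).le ω

lemma bddAbove_T_lt (n : ℕ) : BddAbove {k | S.T k ω < n} :=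
  ⟨n, fun k hk => ((strictMono_T hinf).le_apply (x := k)).trans hk.le⟩

lemma T_nu_lt {n : ℕ} (hn : 0 < n) : S.T (S.nu n ω) ω < n :=
  Nat.sSup_mem (s := {k | S.T k ω < n}) ⟨0, by simpa [T] using hn⟩ (bddAbove_T_lt hinf n)

/-- The last renewal time before `n` is not earlier than any visit to `y₀` before `n`. -/
lemma le_T_nu {n t : ℕ} (ht : t < n) (hhit : S.hitY0 ω t) : t ≤ S.T (S.nu n ω) ω := by
  by_contra! hlt
  have h1 : S.T (S.nu n ω + 1) ω ≤ t := Nat.sInf_le ⟨hlt, hhit⟩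
  have h2 : S.nu n ω + 1 ≤ S.nu n ω := le_csSup (bddAbove_T_lt hinf n) (h1.trans_lt ht)
  omega

lemma Z_eq_R (n : ℕ) : S.Z n ω = S.R (S.T (S.nu n ω) ω) ω := sum_zeta_eq_R hinf _

lemma abs_R_sub_Z_le {n t : ℕ} (ht : t < n) (hhit : S.hitY0 ω t) :
    |(S.R n ω : ℝ) - S.Z n ω| ≤ n - t := by
  have h1 : S.Z n ω ≤ S.R n ω := by
    rw [Z_eq_R hinf]; exact R_mono ω (T_nu_lt hinf (by omega)).le
  have h2 : S.R n ω ≤ S.Z n ω + (n - t) := by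
    rw [Z_eq_R hinf]
    exact (R_le_R_add ht.le ω).trans (by gcongr; exact R_mono ω (le_T_nu hinf ht hhit))
  have h1' : (S.Z n ω : ℝ) ≤ S.R n ω := by exact_mod_cast h1
  have h2' : (S.R n ω : ℝ) ≤ S.Z n ω + (n - t) := by
    rw [← Nat.cast_sub ht.le]; exact_mod_cast h2
  rw [abs_of_nonneg (by linarith)]
  linarith

end Renewal

/-- The difference `R(n) - Z(n)` has exponential tails, uniformly in `n`. -/
lemma measure_lt_abs_R_sub_Z_le {δ1 δ2 : ℝ} (h : S.CondA δ1 δ2) {n m : ℕ} (hm : m * v < n) :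
    S.P {ω | (m * v + 1 : ℝ) < |(S.R n ω : ℝ) - S.Z n ω|} ≤
      ENNReal.ofReal (1 - min δ2 (1 - δ1) ^ v) ^ m := by
  refine (measure_mono_ae ?_).trans (measure_noBlock_le h (n - 1 - m * v) m)
  filter_upwards [ae_frequently_hitY0 h] with ω hω hlt i hi hb
  have hiv : i * v + v ≤ m * v := by
    rw [← Nat.succ_mul]; exact Nat.mul_le_mul_right _ hi
  have hle := abs_R_sub_Z_le (n := n) hω (by omega) (hitY0_of_mem_block hb)
  have hlt : (m * v + 1 : ℝ) < |(S.R n ω : ℝ) - S.Z n ω| := hlt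
  have hn : (n : ℝ) ≤ ((n - 1 - m * v + i * v + v : ℕ) : ℝ) + (m * v + 1) := by
    have : n ≤ n - 1 - m * v + i * v + v + (m * v + 1) := by omega
    exact_mod_cast this
  linarith

/-- The superexponential smallness of `R(n) - Z(n)` on the scale `κ`. -/
lemma tendsto_log_measure_lt_abs_R_sub_Z {δ1 δ2 : ℝ} (h : S.CondA δ1 δ2) {κ : ℕ → ℝ}
    (hκ1 : Tendsto (fun n : ℕ => κ n / n) atTop (nhds 0))
    (hκ2 : Tendsto (fun n : ℕ => κ n / Real.sqrt n) atTop atTop) {ε : ℝ} (hε : 0 < ε) :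
    Tendsto (fun n : ℕ => (((n : ℝ) / κ n ^ 2 : ℝ) : EReal) *
      ENNReal.log (S.P {ω | ε < |(S.R n ω : ℝ) - (S.Z n ω : ℝ)| / κ n})) atTop (nhds ⊥) := by
  have hv : (0 : ℝ) < v := by exact_mod_cast S.hv
  have hq0 : 0 < min δ2 (1 - δ1) := lt_min h.2.1 (by linarith [h.2.2.2.1])
  have hq1 : min δ2 (1 - δ1) < 1 := (min_le_left _ _).trans_lt (h.2.2.1.trans h.2.2.2.1)
  set c := min δ2 (1 - δ1) ^ v with hc
  have hc0 : 0 < c := pow_pos hq0 v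
  have hc1 : c < 1 := pow_lt_one₀ hq0.le hq1 S.hv.ne'
  set L := -Real.log (1 - c) with hL
  have hL0 : 0 < L := neg_pos.mpr (Real.log_neg (by linarith) (by linarith))
  have hsqrt : Tendsto (fun n : ℕ => Real.sqrt n) atTop atTop :=
    Real.tendsto_sqrt_atTop.comp tendsto_natCast_atTop_atTop
  have hκ : Tendsto κ atTop atTop := by
    refine (hκ2.atTop_mul_atTop₀ hsqrt).congr' ?_
    filter_upwards [eventually_gt_atTop 0] with n hn
    have : Real.sqrt n ≠ 0 := by positivity
    field_simp
  have hinv : Tendsto (fun n : ℕ => (n : ℝ) / κ n) atTop atTop := by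
    have : Tendsto (fun n : ℕ => κ n / n) atTop (nhdsWithin 0 (Set.Ioi 0)) := by
      refine tendsto_nhdsWithin_iff.mpr ⟨hκ1, ?_⟩
      filter_upwards [eventually_gt_atTop 0, hκ.eventually_gt_atTop 0] with n hn hk
      exact div_pos hk (by exact_mod_cast hn)
    exact this.inv_tendsto_nhdsGT_zero.congr fun n => by simp
  rw [EReal.tendsto_nhds_bot_iff_real]
  intro M
  filter_upwards [eventually_gt_atTop 0, hκ.eventually_gt_atTop 0,
    hκ.eventually_ge_atTop (2 * (1 + v) / ε), hκ1.eventually_lt_const (u := 1 / ε) (by positivity),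
    hinv.eventually_gt_atTop (-M * (2 * v) / (ε * L))] with n hn hk hk2 hkn hM
  have hn' : (0 : ℝ) < n := by exact_mod_cast hn
  rw [div_le_iff₀ hε] at hk2
  rw [div_lt_div_iff₀ hn' hε, one_mul] at hkn
  rw [div_lt_iff₀ (by positivity)] at hM
  set m := ⌊(ε * κ n - 1) / v⌋₊ with hm
  have hm1 : (m : ℝ) * v + 1 ≤ ε * κ n := by
    have := Nat.floor_le (a := (ε * κ n - 1) / v) (div_nonneg (by nlinarith) hv.le)
    rw [← hm, le_div_iff₀ hv] at this
    linarith
  have hm2 : ε * κ n / (2 * v) ≤ m := by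
    have := Nat.lt_floor_add_one ((ε * κ n - 1) / v)
    rw [← hm, div_lt_iff₀ hv] at this
    rw [div_le_iff₀ (by positivity)]
    nlinarith
  have hmn : m * v < n := by
    have : (m : ℝ) * v < n := by linarith
    exact_mod_cast this
  have hP : S.P {ω | ε < |(S.R n ω : ℝ) - (S.Z n ω : ℝ)| / κ n} ≤ ENNReal.ofReal (1 - c) ^ m := by
    refine (measure_mono fun ω hω => ?_).trans (measure_lt_abs_R_sub_Z_le h hmn)
    exact hm1.trans_lt ((lt_div_iff₀ hk).mp hω)
  have hlog : ENNReal.log (S.P {ω | ε < |(S.R n ω : ℝ) - (S.Z n ω : ℝ)| / κ n}) ≤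
      ((-(m * L) : ℝ) : EReal) := by
    refine (ENNReal.log_monotone hP).trans_eq ?_
    rw [← ENNReal.ofReal_pow (by linarith), ENNReal.log_ofReal_of_pos (by apply pow_pos; linarith),
      Real.log_pow, hL]
    simp
  refine (mul_le_mul_of_nonneg_left hlog (EReal.coe_nonneg.mpr (by positivity))).trans_lt ?_
  rw [← EReal.coe_mul, EReal.coe_lt_coe_iff]
  have hlow : (n : ℝ) / κ n ^ 2 * (ε * κ n / (2 * v)) * L ≤ n / κ n ^ 2 * m * L := by gcongr
  have heq : (n : ℝ) / κ n ^ 2 * (ε * κ n / (2 * v)) * L = n / κ n * (ε * L) / (2 * v) := by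
    field_simp
  have hM' : -M < n / κ n * (ε * L) / (2 * v) := (lt_div_iff₀ (by positivity)).mpr hM
  linarith

end Chain

/-- from the proof of Theorem 1.5(5): if `κ_n/n → 0` and
`κ_n/√n → ∞`, then for every `ε > 0`,
`(n/κ_n²) ln P(|R(n) - Z(n)|/κ_n > ε) → -∞` (exponential equivalence of
`R̃(n) = (R(n) - an)/κ_n` and `Z̃(n) = (Z(n) - an)/κ_n` at speed `κ_n²/n`); in
particular `R̃(n)` and `Z̃(n)` satisfy the same large deviation principles with
normalizing function `κ_n²/n`. -/
theorem statement16 {v : ℕ} {p : ℕ → (Fin (v - 1) → Bool) → ℝ} (S : VLMC v p)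
    (hA : ∃ δ1 δ2 : ℝ, S.CondA δ1 δ2)
    (κ : ℕ → ℝ)
    (hκ1 : Filter.Tendsto (fun n : ℕ => κ n / n) Filter.atTop (nhds 0))
    (hκ2 : Filter.Tendsto (fun n : ℕ => κ n / Real.sqrt n) Filter.atTop Filter.atTop) :
    (∀ ε > (0 : ℝ),
      Filter.Tendsto
        (fun n : ℕ => (((n : ℝ) / κ n ^ 2 : ℝ) : EReal) *
          ENNReal.log (S.P {ω | ε < |(S.R n ω : ℝ) - (S.Z n ω : ℝ)| / κ n}))
        Filter.atTop (nhds ⊥)) ∧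
    ∀ I : ℝ → EReal,
      (SatisfiesLDP S.P (fun n ω => ((S.R n ω : ℝ) - S.a * n) / κ n)
          (fun n => κ n ^ 2 / n) I ↔
        SatisfiesLDP S.P (fun n ω => ((S.Z n ω : ℝ) - S.a * n) / κ n)
          (fun n => κ n ^ 2 / n) I) := by
  let := S.mΩ
  have := S.hprob
  obtain ⟨δ1, δ2, h⟩ := hA
  have hexp : ∀ ε > (0 : ℝ), _ := fun ε hε =>
    tendsto_log_measure_lt_abs_R_sub_Z h hκ1 hκ2 hε
  have hpos : ∀ᶠ n in atTop, 0 < κ n := by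
    filter_upwards [hκ2.eventually_gt_atTop 0] with n hn
    by_contra! hk
    exact absurd (div_nonpos_of_nonpos_of_nonneg hk (Real.sqrt_nonneg n)) (not_le.mpr hn)
  have hequiv : ∀ ε > (0 : ℝ), Tendsto (fun n => (((κ n ^ 2 / n)⁻¹ : ℝ) : EReal) *
      ENNReal.log (S.P {ω | ε < |((S.R n ω : ℝ) - S.a * n) / κ n -
        ((S.Z n ω : ℝ) - S.a * n) / κ n|})) atTop (nhds ⊥) := by
    intro ε hε
    refine (hexp ε hε).congr' ?_
    filter_upwards [hpos] with n hn
    rw [inv_div]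
    simp only [← sub_div, sub_sub_sub_cancel_right, abs_div, abs_of_pos hn]
  refine ⟨hexp, fun I => ⟨fun hR => hR.of_exponentially_equivalent hequiv,
    fun hZ => hZ.of_exponentially_equivalent ?_⟩⟩
  simpa only [abs_sub_comm] using hequiv

end VLMC
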